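/- No-density rates without bounded loss: under the no-density separation P_{X∼ρ_X}(d(g*(X),F) < t₀) = 0 for some t₀ > 0, Z finite, and concentration sup_{x∈supp ρ_X} P(‖g_n(ω,x) − g*(x)‖ > t) ≤ exp(−L t²/(1 + M t)) for all t > 0 (L, M > 0), the excess risk satisfies E_ω[R(f_n(ω))] − R(f*) ≤ 4 c_ψ L^{−1/2} exp(−t₀² L / 2)^{1/2} + 4 c_ψ M L^{−1} exp(−t₀ L / (2M)). -/

import Mathlib

open MeasureTheory ProbabilityTheory Real
open scoped RealInnerProductSpace ENNReal

noncomputable section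

variable {X Y Z H Ω : Type*}
variable [TopologicalSpace X] [PolishSpace X] [MeasurableSpace X] [BorelSpace X]
variable [MeasurableSpace Y] [MeasurableSpace Ω]
variable [Fintype Z] [Nonempty Z] [MeasurableSpace Z] [MeasurableSingletonClass Z]
variable [NormedAddCommGroup H] [InnerProductSpace ℝ H] [CompleteSpace H]
variable [SecondCountableTopology H] [MeasurableSpace H] [BorelSpace H]

/-- The risk of a predictor `f : X → Z` for the loss `ℓ(z, y) = ⟪ψ z, φ y⟫`. -/
def risk (ψ : Z → H) (φ : Y → H) (ρ : Measure (X × Y)) (f : X → Z) : ℝ :=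
  ∫ p, ⟪ψ (f p.1), φ p.2⟫ ∂ρ

/-- The surrogate conditional mean `g*(x) = E_{Y ∼ ρ|ₓ}[φ(Y)]`, where `κ x = ρ|ₓ`. -/
def gStar (φ : Y → H) (κ : Kernel X Y) (x : X) : H :=
  ∫ y, φ y ∂(κ x)

/-- `f` is a (measurable) decoding of `g : X → H`. -/
def IsDecoding (ψ : Z → H) (g : X → H) (f : X → Z) : Prop :=
  Measurable f ∧ ∀ x z, ⟪ψ (f x), g x⟫ ≤ ⟪ψ z, g x⟫

/-- The decision frontier `F`. -/
def decisionFrontier (ψ : Z → H) : Set H :=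
  {ξ | ∃ z₁ z₂ : Z, z₁ ≠ z₂ ∧ (∀ z, ⟪ψ z₁, ξ⟫ ≤ ⟪ψ z, ξ⟫) ∧ ∀ z, ⟪ψ z₂, ξ⟫ ≤ ⟪ψ z, ξ⟫}

/-- Distance (in `ℝ≥0∞`) from a point to the decision frontier. -/
def dF (ψ : Z → H) (ξ : H) : ℝ≥0∞ :=
  EMetric.infEdist ξ (decisionFrontier ψ)

/-- The (topological) support of a measure: points all of whose neighborhoods have
positive mass. -/
def msupp (μ : Measure X) : Set X :=
  {x | ∀ U : Set X, IsOpen U → x ∈ U → 0 < μ U}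

/-- pointwise inequality, small m -/
theorem aux_small (a m : ℝ) (ha : 0 ≤ a) (hm : 0 ≤ m) (hm1 : m ≤ 1) :
    a * m * (2 + m) / (1 + m)^2 * exp (-(a*m/(1+m))) ≤ √(a*m) * exp (-(a*m/4)) := by
  set s := √(a*m) with hs
  have hs0 : 0 ≤ s := Real.sqrt_nonneg _
  have hss : a * m = s^2 := (Real.sq_sqrt (by positivity)).symm
  rw [hss]
  set y := (3 - m) / (2*(1+m)) * s^2 with hy
  have h1 : y * exp 1 ≤ exp y := by
    have := add_one_le_exp (y - 1)
    have h2 : exp y = exp (y-1) * exp 1 := by rw [← exp_add]; ring_nf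
    rw [h2]
    exact mul_le_mul_of_nonneg_right (by linarith) (exp_pos _).le
  have he : (2.7 : ℝ) < exp 1 := by have := exp_one_gt_d9; linarith
  have hy0 : 0 ≤ y := by
    have : 0 ≤ 3 - m := by linarith
    positivity
  have hpoly : 2 * (2+m)^2 ≤ 2.7 * ((1+m)^3 * (3-m)) := by
    nlinarith [mul_nonneg hm hm, mul_nonneg hm (mul_nonneg hm hm), mul_nonneg (mul_nonneg hm hm) (mul_nonneg hm (sub_nonneg.2 hm1)), mul_nonneg (mul_nonneg hm hm) (sub_nonneg.2 hm1)]
  have h3 : (s * (2+m) / (1+m)^2)^2 ≤ exp y := by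
    have : (s * (2+m) / (1+m)^2)^2 ≤ y * 2.7 := by
      rw [hy, div_pow, div_le_iff₀ (by positivity)]
      have : (3 - m) / (2 * (1 + m)) * s ^ 2 * 2.7 * ((1 + m) ^ 2) ^ 2 = s^2 * (2.7 * ((1+m)^3 * (3-m))) / 2 := by
        field_simp
      rw [this]
      nlinarith [mul_le_mul_of_nonneg_left hpoly (sq_nonneg s)]
    nlinarith
  have h4 : s * (2+m) / (1+m)^2 ≤ exp (y/2) := by
    apply le_of_sq_le_sq _ (exp_pos _).le
    have e : exp (y/2)^2 = exp y := by rw [sq, ← exp_add]; congr 1; ring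
    rw [e]; exact h3
  have h5 : exp (-(s^2/4)) = exp (y/2) * exp (-(s^2/(1+m))) := by
    rw [← exp_add]; congr 1; rw [hy]; field_simp; ring
  rw [h5]
  have : s^2 * (2 + m) / (1 + m)^2 * exp (-(s^2/(1+m))) = s * ((s * (2+m) / (1+m)^2) * exp (-(s^2/(1+m)))) := by ring
  rw [this]
  gcongr

theorem aux_mid (a m : ℝ) (ha : 0 ≤ a) (hm : 1 ≤ m) (hm3 : m ≤ 3) :
    a * m * (2 + m) / (1 + m)^2 * exp (-(a*m/(1+m))) ≤ √(a*m) * exp (-(a*m/4)) + exp (-(a/2)) := by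
  set r := √a with hr
  have hr0 : 0 ≤ r := Real.sqrt_nonneg _
  have hrr : a = r^2 := (Real.sq_sqrt (by positivity)).symm
  have hq : m * (2+m)/(1+m)^2 ≤ 1 := by
    rw [div_le_one (by positivity)]; nlinarith
  have hsq : r ≤ √(a*m) := Real.sqrt_le_sqrt (by nlinarith)
  -- lower bound
  have hx : r * exp (-(a*m/4)) ≤ √(a*m) * exp (-(a*m/4)) := by gcongr
  have h0 : a * m * (2 + m) / (1 + m)^2 * exp (-(a*m/(1+m))) ≤ a * exp (-(a*m/(1+m))) := by
    have : a * m * (2 + m) / (1 + m)^2 = a * (m * (2+m)/(1+m)^2) := by ring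
    rw [this]; gcongr; nlinarith
  have key : a * exp (-(a*m/(1+m))) ≤ r * exp (-(a*m/4)) + exp (-(a/2)) := by
    apply le_of_sq_le_sq _ (by positivity)
    have h4 : 4 * (r * exp (-(a*m/4))) * exp (-(a/2)) ≤ (r * exp (-(a*m/4)) + exp (-(a/2)))^2 := by
      nlinarith [sq_nonneg (r * exp (-(a*m/4)) - exp (-(a/2)))]
    refine le_trans ?_ h4
    have e1 : 2 * (a*m/(1+m)) ≥ a*m/4 + a/2 + a/4 := by
      rw [ge_iff_le, ← sub_nonneg]
      have : 2 * (a*m/(1+m)) - (a*m/4 + a/2 + a/4) = a * ((m-1)*(3-m)) / (4*(1+m)) := by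
        field_simp; ring
      rw [this]
      have : 0 ≤ (m-1)*(3-m) := mul_nonneg (by linarith) (by linarith)
      positivity
    have e2 : a^2 * exp (-(a/4)) ≤ 4 * r := by
      have h6 : r^2/6 * exp 1 ≤ exp (r^2/6) := by
        have := add_one_le_exp (r^2/6 - 1)
        have h2 : exp (r^2/6) = exp (r^2/6-1) * exp 1 := by rw [← exp_add]; ring_nf
        rw [h2]
        exact mul_le_mul_of_nonneg_right (by linarith) (exp_pos _).le
      have he : (2.7 : ℝ) < exp 1 := by have := exp_one_gt_d9; linarith
      have h7 : r^2 * (2.7/6) ≤ exp (r^2/6) := by nlinarith [sq_nonneg r]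
      have h8 : (r^2 * (2.7/6))^3 ≤ exp (r^2/6)^3 := by gcongr
      have h9 : exp (r^2/6)^3 = exp (r^2/4)^2 := by
        rw [← exp_nat_mul, ← exp_nat_mul]; congr 1; push_cast; ring
      have h10 : r^3 ≤ 4 * exp (r^2/4) := by
        apply le_of_sq_le_sq _ (by positivity)
        rw [h9] at h8
        nlinarith [sq_nonneg (exp (r^2/4))]
      rw [hrr, exp_neg, ← div_eq_mul_inv, div_le_iff₀ (exp_pos _)]
      nlinarith
    calc (a * exp (-(a*m/(1+m))))^2 = a^2 * exp (-(2*(a*m/(1+m)))) := by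
          rw [mul_pow, ← exp_nat_mul]; congr 2; push_cast; ring
      _ ≤ a^2 * exp (-(a*m/4 + a/2 + a/4)) := by gcongr
      _ = (a^2 * exp (-(a/4))) * (exp (-(a*m/4)) * exp (-(a/2))) := by
          rw [mul_assoc, ← exp_add, ← exp_add]; congr 2; ring
      _ ≤ (4 * r) * (exp (-(a*m/4)) * exp (-(a/2))) := by gcongr
      _ = _ := by ring
  linarith

theorem aux_pt (a m : ℝ) (ha : 0 ≤ a) (hm : 0 ≤ m) (hm3 : m ≤ 3) :
    a * m * (2 + m) / (1 + m)^2 * exp (-(a*m/(1+m))) ≤ √(a*m) * exp (-(a*m/4)) + exp (-(a/2)) := by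
  rcases le_total m 1 with h | h
  · have := aux_small a m ha hm h
    have := exp_pos (-(a/2))
    linarith
  · exact aux_mid a m ha h hm3

theorem aux_big (a m : ℝ) (ha : 0 ≤ a) (hm : 3 ≤ m) :
    (a + 16/15) * exp (-(a*m/(1+m))) ≤ 2 * exp (-(a/2)) := by
  have h1 : 3*a/4 ≤ a*m/(1+m) := by
    rw [div_le_div_iff₀ (by positivity) (by positivity)]; nlinarith
  have h2 : a + 16/15 ≤ 2 * exp (a/4) := by
    have := add_one_le_exp (a/4 - log 2)
    rw [exp_sub, exp_log (by norm_num)] at this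
    have := log_two_lt_d9
    linarith
  calc (a + 16/15) * exp (-(a*m/(1+m))) ≤ (2 * exp (a/4)) * exp (-(3*a/4)) := by gcongr
    _ = _ := by rw [mul_assoc, ← exp_add]; congr 2; ring

def hh (L M t : ℝ) : ℝ := exp (-(L * t ^ 2) / (1 + M * t))

theorem hh_pos (L M t : ℝ) : 0 < hh L M t := exp_pos _

theorem hh_deriv (L M t : ℝ) (hM : 0 < M) (ht : 0 < t) :
    HasDerivAt (hh L M) (-(L * (2*t + M*t^2)/(1+M*t)^2 * hh L M t)) t := by
  have hne : 1 + M * t ≠ 0 := by positivity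
  have h1 : HasDerivAt (fun t : ℝ => -(L * t^2)) (-(L * (2 * t))) t := by
    have := ((hasDerivAt_pow 2 t).const_mul L).neg
    refine HasDerivAt.congr_deriv this ?_
    simp
  have h2 : HasDerivAt (fun t : ℝ => 1 + M * t) M t := by
    have := ((hasDerivAt_id t).const_mul M).const_add 1
    refine HasDerivAt.congr_deriv this ?_
    simp
  have h3 := (h1.div h2 hne).exp
  refine HasDerivAt.congr_deriv h3 ?_
  unfold hh
  simp only [Pi.div_apply]
  symm
  rw [mul_comm, neg_mul_eq_mul_neg]
  congr 1
  field_simp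
  ring

theorem hh_contOn (L M : ℝ) (hM : 0 < M) : ContinuousOn (hh L M) (Set.Ioi 0) :=
  fun t ht => (hh_deriv L M t hM ht).continuousAt.continuousWithinAt

theorem tail_big (L M T : ℝ) (hL : 0 < L) (hM : 0 < M) (hT : 3 ≤ M * T) :
    IntegrableOn (hh L M) (Set.Ioi T) ∧
      ∫ t in Set.Ioi T, hh L M t ≤ 16/15 * (M/L) * hh L M T := by
  have hT0 : 0 < T := by
    by_contra h
    nlinarith
  set g : ℝ → ℝ := fun t => 16/15 * (M/L) * hh L M t with hg
  set g' : ℝ → ℝ := fun t => 16/15 * (M/L) * (-(L * (2*t + M*t^2)/(1+M*t)^2 * hh L M t)) with hg'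
  have hd : ∀ t, 0 < t → HasDerivAt g (g' t) t := fun t ht =>
    (hh_deriv L M t hM ht).const_mul _
  have hle : ∀ t ∈ Set.Ioi T, hh L M t ≤ - g' t := by
    intro t ht
    have ht' : T < t := ht
    have ht0 : 0 < t := hT0.trans ht'
    have hm : 3 ≤ M * t := hT.trans (by gcongr)
    have : -g' t = (16/15 * ((M*t) * (2 + M*t)/(1+M*t)^2)) * hh L M t := by
      simp only [hg']; field_simp
    rw [this]
    have h1 : 1 ≤ 16/15 * ((M*t) * (2 + M*t)/(1+M*t)^2) := by
      rw [mul_div_assoc', le_div_iff₀ (by positivity)]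
      nlinarith
    nlinarith [hh_pos L M t]
  have hnp : ∀ t ∈ Set.Ioi T, g' t ≤ 0 := fun t ht => by
    have := hle t ht; have := hh_pos L M t; linarith
  have hlim0 : Filter.Tendsto (hh L M) Filter.atTop (nhds 0) := by
    have hb : Filter.Tendsto (fun t : ℝ => exp (-(3*L/(4*M) * t))) Filter.atTop (nhds 0) := by
      apply tendsto_exp_neg_atTop_nhds_zero.comp
      exact Filter.tendsto_id.const_mul_atTop (by positivity)
    refine tendsto_of_tendsto_of_tendsto_of_le_of_le' tendsto_const_nhds hb
      (Filter.Eventually.of_forall fun t => (hh_pos L M t).le) ?_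
    filter_upwards [Filter.eventually_ge_atTop T] with t ht
    have ht0 : 0 < t := hT0.trans_le ht
    have hm : 3 ≤ M * t := hT.trans (by gcongr)
    unfold hh
    apply exp_le_exp.2
    rw [neg_div, neg_le_neg_iff, div_mul_eq_mul_div, div_le_div_iff₀ (by positivity) (by positivity)]
    have : 0 ≤ L * t * (M * t - 3) := mul_nonneg (by positivity) (by linarith)
    nlinarith
  have hlim : Filter.Tendsto g Filter.atTop (nhds 0) := by
    have := hlim0.const_mul (16/15 * (M/L))
    simpa [hg] using this
  have hc : ContinuousWithinAt g (Set.Ici T) T := (hd T hT0).continuousAt.continuousWithinAt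
  have hd' : ∀ t ∈ Set.Ioi T, HasDerivAt g (g' t) t := fun t ht => hd t (hT0.trans ht)
  have hI := integrableOn_Ioi_deriv_of_nonpos hc hd' hnp hlim
  have hE := integral_Ioi_of_hasDerivAt_of_nonpos hc hd' hnp hlim
  have hint : IntegrableOn (hh L M) (Set.Ioi T) := by
    refine Integrable.mono' hI.neg ?_ ?_
    · exact ((hh_contOn L M hM).mono (Set.Ioi_subset_Ioi hT0.le)).aestronglyMeasurable measurableSet_Ioi
    · filter_upwards [ae_restrict_mem measurableSet_Ioi] with t ht
      rw [Real.norm_of_nonneg (hh_pos L M t).le]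
      exact hle t ht
  refine ⟨hint, ?_⟩
  have h2 : ∫ t in Set.Ioi T, hh L M t ≤ ∫ t in Set.Ioi T, - g' t :=
    setIntegral_mono_on hint hI.neg measurableSet_Ioi hle
  rw [integral_neg, hE] at h2
  simpa [hg] using h2

def BB (L M t : ℝ) : ℝ := 2 / √L * exp (-(L*t^2/4)) + 2 * (M/L) * exp (-(L/(2*M)*t))

theorem BB_deriv (L M t : ℝ) (hL : 0 < L) (hM : 0 < M) :
    HasDerivAt (BB L M) (-(√L * t * exp (-(L*t^2/4)) + exp (-(L/(2*M)*t)))) t := by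
  have hs : √L ≠ 0 := by positivity
  have hss : √L * √L = L := Real.mul_self_sqrt hL.le
  have h1 : HasDerivAt (fun t : ℝ => -(L * t^2/4)) (-(L * (2 * t)/4)) t := by
    have := (((hasDerivAt_pow 2 t).const_mul L).div_const 4).neg
    refine HasDerivAt.congr_deriv this ?_
    simp
  have h2 : HasDerivAt (fun t : ℝ => -(L/(2*M) * t)) (-(L/(2*M))) t := by
    have := ((hasDerivAt_id t).const_mul (L/(2*M))).neg
    refine HasDerivAt.congr_deriv this ?_
    simp
  have := (h1.exp.const_mul (2/√L)).add (h2.exp.const_mul (2*(M/L)))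
  refine HasDerivAt.congr_deriv this ?_
  have e1 : 2 / √L * (exp (-(L * t ^ 2 / 4)) * -(L * (2 * t) / 4)) = -(√L * t * exp (-(L*t^2/4))) := by
    field_simp
    rw [Real.sq_sqrt hL.le]
    ring
  have e2 : 2 * (M / L) * (exp (-(L / (2 * M) * t)) * -(L / (2 * M))) = - exp (-(L/(2*M)*t)) := by
    field_simp
  rw [e1, e2]; ring

theorem tail_main (L M T : ℝ) (hL : 0 < L) (hM : 0 < M) (hT0 : 0 < T) :
    IntegrableOn (hh L M) (Set.Ioi T) ∧
      T * hh L M T + ∫ t in Set.Ioi T, hh L M t ≤ BB L M T := by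
  have big : ∀ T, 0 < T → 3 ≤ M * T → IntegrableOn (hh L M) (Set.Ioi T) ∧
      T * hh L M T + ∫ t in Set.Ioi T, hh L M t ≤ BB L M T := by
    intro T hT0 hT
    obtain ⟨h1, h2⟩ := tail_big L M T hL hM hT
    refine ⟨h1, ?_⟩
    have h3 := aux_big (L*T/M) (M*T) (by positivity) hT
    have e1 : exp (-(L*T/M*(M*T)/(1+M*T))) = hh L M T := by
      unfold hh; congr 1; field_simp
    have e2 : L*T/M/2 = L/(2*M)*T := by field_simp
    rw [e1, e2] at h3
    have h4 : M/L * ((L*T/M + 16/15) * hh L M T) ≤ M/L * (2 * exp (-(L/(2*M)*T))) := by gcongr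
    have e3 : M/L * ((L*T/M + 16/15) * hh L M T) = T * hh L M T + 16/15*(M/L)*hh L M T := by
      field_simp
    have h5 : 0 ≤ 2 / √L * exp (-(L*T^2/4)) := by positivity
    unfold BB
    linarith
  rcases le_total 3 (M*T) with h | h
  · exact big T hT0 h
  set S := 3 / M with hS
  have hS0 : 0 < S := by positivity
  have hMS : M * S = 3 := by rw [hS]; field_simp
  have hTS : T ≤ S := by rw [hS, le_div_iff₀ hM]; linarith
  obtain ⟨i1, i2⟩ := big S hS0 hMS.ge
  have hcI : ContinuousOn (hh L M) (Set.Icc T S) :=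
    (hh_contOn L M hM).mono fun t ht => hT0.trans_le ht.1
  have hII : IntegrableOn (hh L M) (Set.Icc T S) := hcI.integrableOn_Icc
  have hun : Set.Ioi T = Set.Ioc T S ∪ Set.Ioi S := (Set.Ioc_union_Ioi_eq_Ioi hTS).symm
  have hIoc : IntegrableOn (hh L M) (Set.Ioc T S) := hII.mono_set Set.Ioc_subset_Icc_self
  refine ⟨by rw [hun]; exact hIoc.union i1, ?_⟩
  rw [hun, setIntegral_union (Set.Ioc_disjoint_Ioi le_rfl) measurableSet_Ioi hIoc i1,
    ← intervalIntegral.integral_of_le hTS]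
  have hKd : ∀ t, 0 < t → HasDerivAt (fun t => t * hh L M t - BB L M t)
      (1 * hh L M t + t * (-(L * (2*t + M*t^2)/(1+M*t)^2 * hh L M t))
        - (-(√L * t * exp (-(L*t^2/4)) + exp (-(L/(2*M)*t))))) t := fun t ht =>
    ((hasDerivAt_id t).mul (hh_deriv L M t hM ht)).sub (BB_deriv L M t hL hM)
  have := intervalIntegral.integral_le_sub_of_hasDeriv_right_of_le (φ := hh L M) hTS
    (fun t ht => (hKd t (hT0.trans_le ht.1)).continuousAt.continuousWithinAt)
    (fun t ht => (hKd t (hT0.trans ht.1)).hasDerivWithinAt) hII (by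
      intro t ht
      have ht0 : 0 < t := hT0.trans ht.1
      have hm : M * t ≤ 3 := by rw [← hMS]; have := ht.2.le; gcongr
      have hp := aux_pt (L*t/M) (M*t) (by positivity) (by positivity) hm
      have e0 : L*t/M*(M*t) = L*t^2 := by field_simp
      have e1 : exp (-(L*t^2/(1+M*t))) = hh L M t := by
        unfold hh; congr 1; ring
      have e2 : L*t/M/2 = L/(2*M)*t := by field_simp
      have e3 : √(L*t^2) = √L * t := by rw [Real.sqrt_mul hL.le, Real.sqrt_sq ht0.le]
      rw [e0, e1, e2, e3] at hp
      have e4 : L * t ^ 2 * (2 + M * t) / (1 + M * t) ^ 2 * hh L M t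
        = t * (L * (2*t + M*t^2)/(1+M*t)^2 * hh L M t) := by ring
      rw [e4] at hp
      linarith)
  linarith

theorem layer {Ω : Type*} [MeasurableSpace Ω] (P : Measure Ω) [IsProbabilityMeasure P]
    (W : Ω → ℝ) (hW : Measurable W) (hW0 : ∀ ω, 0 ≤ W ω) (L M T : ℝ) (hL : 0 < L) (hM : 0 < M)
    (hT0 : 0 < T) (hc : ∀ t : ℝ, 0 < t → P {ω | t < W ω} ≤ ENNReal.ofReal (hh L M t)) :
    Integrable ({ω | T ≤ W ω}.indicator W) P ∧
      ∫ ω, {ω | T ≤ W ω}.indicator W ω ∂P ≤ BB L M T := by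
  have hms : MeasurableSet {ω | T ≤ W ω} := measurableSet_le measurable_const hW
  set V := {ω | T ≤ W ω}.indicator W with hV
  have hVm : Measurable V := hW.indicator hms
  have hV0 : ∀ ω, 0 ≤ V ω := fun ω => Set.indicator_nonneg (fun ω _ => hW0 ω) ω
  obtain ⟨hI, hB⟩ := tail_main L M T hL hM hT0
  have hPT : P {ω | T ≤ W ω} ≤ ENNReal.ofReal (hh L M T) := by
    have hlim : Filter.Tendsto (fun t => ENNReal.ofReal (hh L M t)) (nhdsWithin T (Set.Iio T))
        (nhds (ENNReal.ofReal (hh L M T))) :=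
      (ENNReal.continuous_ofReal.tendsto _).comp
        ((hh_deriv L M T hM hT0).continuousAt.continuousWithinAt)
    refine ge_of_tendsto hlim ?_
    filter_upwards [Ioo_mem_nhdsLT hT0] with t ht
    refine (measure_mono ?_).trans (hc t ht.1)
    intro ω hω
    exact lt_of_lt_of_le ht.2 hω
  have hl : ∫⁻ ω, ENNReal.ofReal (V ω) ∂P ≤ ENNReal.ofReal (BB L M T) := by
    rw [lintegral_eq_lintegral_meas_lt P (Filter.Eventually.of_forall hV0) hVm.aemeasurable]
    rw [← Set.Ioc_union_Ioi_eq_Ioi hT0.le,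
      lintegral_union measurableSet_Ioi (Set.Ioc_disjoint_Ioi le_rfl)]
    have h1 : ∫⁻ t in Set.Ioc 0 T, P {a | t < V a} ≤ ENNReal.ofReal (T * hh L M T) := by
      calc ∫⁻ t in Set.Ioc 0 T, P {a | t < V a}
          ≤ ∫⁻ t in Set.Ioc 0 T, ENNReal.ofReal (hh L M T) := by
            refine setLIntegral_mono' measurableSet_Ioc fun t ht => ?_
            refine (measure_mono ?_).trans hPT
            intro ω hω
            by_contra hn
            have : V ω = 0 := Set.indicator_of_notMem hn _
            have h' : t < V ω := hω
            rw [this] at h'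
            exact absurd ht.1 (not_lt.2 h'.le)
        _ = _ := by
            rw [setLIntegral_const, Real.volume_Ioc, sub_zero, mul_comm, ENNReal.ofReal_mul hT0.le]
    have h2 : ∫⁻ t in Set.Ioi T, P {a | t < V a} ≤ ENNReal.ofReal (∫ t in Set.Ioi T, hh L M t) := by
      rw [ofReal_integral_eq_lintegral_ofReal hI
        (Filter.Eventually.of_forall fun t => (hh_pos L M t).le)]
      refine setLIntegral_mono' measurableSet_Ioi fun t ht => ?_
      refine (measure_mono ?_).trans (hc t (hT0.trans ht))
      intro ω hω
      have h' : t < V ω := hω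
      exact h'.trans_le (Set.indicator_le_self' (fun ω _ => hW0 ω) ω)
    refine (add_le_add h1 h2).trans ?_
    rw [← ENNReal.ofReal_add]
    · exact ENNReal.ofReal_le_ofReal hB
    · exact mul_nonneg hT0.le (hh_pos _ _ _).le
    · exact integral_nonneg fun t => (hh_pos _ _ _).le
  have hint : Integrable V P := by
    refine ⟨hVm.aestronglyMeasurable, ?_⟩
    rw [hasFiniteIntegral_iff_ofReal (Filter.Eventually.of_forall hV0)]
    exact hl.trans_lt ENNReal.ofReal_lt_top
  refine ⟨hint, ?_⟩
  rw [← ofReal_integral_eq_lintegral_ofReal hint (Filter.Eventually.of_forall hV0)] at hl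
  have hBB : 0 ≤ BB L M T := by unfold BB; positivity
  exact (ENNReal.ofReal_le_ofReal_iff hBB).1 hl

theorem frontier_cross (ψ : Z → H) (g g' : H) (z z' : Z) (hne : z ≠ z')
    (hz : ∀ w, ⟪ψ z, g⟫ ≤ ⟪ψ w, g⟫) (hz' : ∀ w, ⟪ψ z', g'⟫ ≤ ⟪ψ w, g'⟫) :
    dF ψ g ≤ ENNReal.ofReal ‖g' - g‖ := by
  have hcl : ∀ w : Z, IsClosed {ξ : H | ∀ v, ⟪ψ w, ξ⟫ ≤ ⟪ψ v, ξ⟫} := by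
    intro w
    rw [Set.setOf_forall]
    exact isClosed_iInter fun v => isClosed_le (by fun_prop) (by fun_prop)
  have hpre : IsPreconnected (segment ℝ g g') := (convex_segment g g').isPreconnected
  rw [isPreconnected_closed_iff] at hpre
  have hcl2 : IsClosed (⋃ w ∈ {w : Z | w ≠ z}, {ξ : H | ∀ v, ⟪ψ w, ξ⟫ ≤ ⟪ψ v, ξ⟫}) :=
    Set.Finite.isClosed_biUnion (Set.toFinite _) fun w _ => hcl w
  obtain ⟨ξ, hξs, hξ1, hξ2⟩ := hpre _ _ (hcl z) hcl2 (by
    intro ξ _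
    obtain ⟨w, hw⟩ := Finite.exists_min (fun v => ⟪ψ v, ξ⟫)
    by_cases h : w = z
    · left; subst h; exact hw
    · right
      simp only [Set.mem_iUnion]
      exact ⟨w, h, hw⟩) ⟨g, left_mem_segment ℝ g g', hz⟩
    ⟨g', right_mem_segment ℝ g g', by
      simp only [Set.mem_iUnion]
      exact ⟨z', hne.symm, hz'⟩⟩
  simp only [Set.mem_iUnion] at hξ2
  obtain ⟨w, hw, hw2⟩ := hξ2
  have hF : ξ ∈ decisionFrontier ψ := ⟨z, w, fun h => hw h.symm, hξ1, hw2⟩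
  refine (Metric.infEDist_le_edist_of_mem hF).trans ?_
  rw [edist_dist, dist_comm, dist_eq_norm]
  apply ENNReal.ofReal_le_ofReal
  rw [segment_eq_image'] at hξs
  obtain ⟨θ, hθ, rfl⟩ := hξs
  simp only [add_sub_cancel_left, norm_smul, Real.norm_of_nonneg hθ.1]
  exact mul_le_of_le_one_left (norm_nonneg _) hθ.2

theorem msupp_ae (μ : Measure X) : ∀ᵐ x ∂μ, x ∈ msupp μ := by
  change μ (msupp μ)ᶜ = 0
  refine measure_null_of_locally_null _ fun x hx => ?_
  simp only [msupp, Set.mem_compl_iff, Set.mem_setOf_eq, not_forall, not_lt] at hx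
  obtain ⟨U, hU, hxU, h0⟩ := hx
  exact ⟨U, mem_nhdsWithin_of_mem_nhds (hU.mem_nhds hxU), le_antisymm h0 (zero_le)⟩

theorem risk_eq (ψ : Z → H) (φ : Y → H) (hφ : Measurable φ) (cψ : ℝ) (hψ : ∀ z, ‖ψ z‖ ≤ cψ)
    (μ : Measure X) [IsProbabilityMeasure μ] (κ : Kernel X Y) [IsMarkovKernel κ]
    (hφ1 : Integrable (fun p : X × Y => φ p.2) (μ ⊗ₘ κ)) (f : X → Z) (hf : Measurable f) :
    risk ψ φ (μ ⊗ₘ κ) f = ∫ x, ⟪ψ (f x), gStar φ κ x⟫ ∂μ := by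
  have hψm : Measurable ψ := measurable_of_finite ψ
  unfold risk
  rw [Measure.integral_compProd]
  · have hae := ((Measure.integrable_compProd_iff hφ1.aestronglyMeasurable).1 hφ1).1
    refine integral_congr_ae ?_
    filter_upwards [hae] with x hx
    exact integral_inner hx (ψ (f x))
  · refine Integrable.mono' (hφ1.norm.const_mul cψ) ?_ ?_
    · exact (Measurable.inner (hψm.comp (hf.comp measurable_fst))
        (hφ.comp measurable_snd)).aestronglyMeasurable
    · refine Filter.Eventually.of_forall fun p => ?_
      refine (norm_inner_le_norm _ _).trans ?_
      gcongr
      exact hψ _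

/-- **No-density rates without bounded loss** (refinement of the no-density theorem): under the
hard margin (no-density) condition and Bernstein-type pointwise exponential concentration, the
expected excess risk is bounded without assuming the loss bounded. -/
theorem rates_no_density_unbounded
    (ψ : Z → H) (φ : Y → H) (cψ : ℝ) (hψ : ∀ z, ‖ψ z‖ ≤ cψ) (hφ : Measurable φ)
    (μ : Measure X) [IsProbabilityMeasure μ] (κ : Kernel X Y) [IsMarkovKernel κ]
    (hφ2 : Integrable (fun p : X × Y => ‖φ p.2‖ ^ 2) (μ ⊗ₘ κ))
    (t₀ : ℝ) (ht₀ : 0 < t₀)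
    (hnodensity : μ {x | dF ψ (gStar φ κ x) < ENNReal.ofReal t₀} = 0)
    (P : Measure Ω) [IsProbabilityMeasure P]
    (gn : Ω → X → H) (hgn : Measurable (Function.uncurry gn))
    (L M : ℝ) (hL : 0 < L) (hM : 0 < M)
    (hconc : ∀ t : ℝ, 0 < t → ∀ x ∈ msupp μ,
      P {ω | t < ‖gn ω x - gStar φ κ x‖} ≤ ENNReal.ofReal (exp (-(L * t ^ 2) / (1 + M * t))))
    (fn : Ω → X → Z) (hfn : ∀ ω, IsDecoding ψ (gn ω) (fn ω))
    (hfnm : Measurable (Function.uncurry fn))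
    (fstar : X → Z) (hfstar : IsDecoding ψ (gStar φ κ) fstar) :
    (∫ ω, risk ψ φ (μ ⊗ₘ κ) (fn ω) ∂P) - risk ψ φ (μ ⊗ₘ κ) fstar
      ≤ 4 * cψ * L ^ (-(1 : ℝ) / 2) * exp (-(t₀ ^ 2 * L) / 2) ^ ((1 : ℝ) / 2)
        + 4 * cψ * M * L⁻¹ * exp (-(t₀ * L) / (2 * M)) := by
  have hcψ : 0 ≤ cψ := (norm_nonneg _).trans (hψ (Classical.arbitrary Z))
  have hψm : Measurable ψ := measurable_of_finite ψ
  have hφ1 : Integrable (fun p : X × Y => φ p.2) (μ ⊗ₘ κ) := by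
    have hm : AEStronglyMeasurable (fun p : X × Y => φ p.2) (μ ⊗ₘ κ) :=
      (hφ.comp measurable_snd).aestronglyMeasurable
    exact ((memLp_two_iff_integrable_sq_norm hm).2 hφ2).integrable one_le_two
  have hgm : Measurable (gStar φ κ) :=
    (StronglyMeasurable.integral_kernel (κ := κ) hφ.stronglyMeasurable).measurable
  have hgI : Integrable (gStar φ κ) μ := by
    refine Integrable.mono'
      ((Measure.integrable_compProd_iff hφ1.aestronglyMeasurable).1 hφ1).2
      hgm.aestronglyMeasurable (Filter.Eventually.of_forall fun x => ?_)
    exact norm_integral_le_integral_norm _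
  -- integrability of pieces
  have hfI : ∀ f : X → Z, Measurable f → Integrable (fun x => ⟪ψ (f x), gStar φ κ x⟫) μ := by
    intro f hf
    refine Integrable.mono' (hgI.norm.const_mul cψ)
      (Measurable.inner (hψm.comp hf) hgm).aestronglyMeasurable
      (Filter.Eventually.of_forall fun x => ?_)
    refine (norm_inner_le_norm _ _).trans ?_
    gcongr
    exact hψ _
  have hnorm2 : ∀ z z', ‖ψ z - ψ z'‖ ≤ 2 * cψ := fun z z' => by
    have := norm_sub_le (ψ z) (ψ z'); have := hψ z; have := hψ z'; linarith
  have hEI : Integrable (Function.uncurry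
      fun (ω : Ω) (x : X) => ⟪ψ (fn ω x) - ψ (fstar x), gStar φ κ x⟫) (P.prod μ) := by
    have hb : Integrable (fun p : Ω × X => 2 * cψ * ‖gStar φ κ p.2‖) (P.prod μ) :=
      (hgI.norm.comp_snd P).const_mul _
    refine Integrable.mono' hb ?_ (Filter.Eventually.of_forall fun p => ?_)
    · refine Measurable.aestronglyMeasurable ?_
      exact Measurable.inner ((hψm.comp hfnm).sub (hψm.comp (hfstar.1.comp measurable_snd)))
        (hgm.comp measurable_snd)
    · refine (norm_inner_le_norm _ _).trans ?_
      gcongr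
      exact hnorm2 _ _
  have hrisk : ∀ ω, risk ψ φ (μ ⊗ₘ κ) (fn ω) =
      (∫ x, ⟪ψ (fn ω x) - ψ (fstar x), gStar φ κ x⟫ ∂μ) + risk ψ φ (μ ⊗ₘ κ) fstar := by
    intro ω
    rw [risk_eq ψ φ hφ cψ hψ μ κ hφ1 _ (hfn ω).1, risk_eq ψ φ hφ cψ hψ μ κ hφ1 _ hfstar.1]
    simp only [inner_sub_left]
    rw [integral_sub (hfI _ (hfn ω).1) (hfI _ hfstar.1)]
    ring
  have hEω : Integrable (fun ω => ∫ x, ⟪ψ (fn ω x) - ψ (fstar x), gStar φ κ x⟫ ∂μ) P :=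
    hEI.integral_prod_left
  simp only [hrisk]
  rw [integral_add hEω (integrable_const _)]
  simp only [integral_const, probReal_univ, one_smul, smul_eq_mul, one_mul, add_sub_cancel_right]
  rw [integral_integral_swap hEI]
  have hpt : ∀ᵐ x ∂μ, ∫ ω, ⟪ψ (fn ω x) - ψ (fstar x), gStar φ κ x⟫ ∂P ≤ 2 * cψ * BB L M t₀ := by
    have hnd : ∀ᵐ x ∂μ, ¬ dF ψ (gStar φ κ x) < ENNReal.ofReal t₀ := by
      rw [ae_iff]; simpa using hnodensity
    filter_upwards [msupp_ae μ, hnd] with x hx hd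
    have hWm : Measurable (fun ω => ‖gn ω x - gStar φ κ x‖) :=
      ((hgn.comp (measurable_id.prodMk measurable_const)).sub measurable_const).norm
    obtain ⟨hI, hB⟩ := layer P (fun ω => ‖gn ω x - gStar φ κ x‖) hWm (fun ω => norm_nonneg _)
      L M t₀ hL hM ht₀ (fun t ht => hconc t ht x hx)
    have hmono := integral_mono_of_nonneg (μ := P)
      (f := fun ω => ⟪ψ (fn ω x) - ψ (fstar x), gStar φ κ x⟫)
      (Filter.Eventually.of_forall fun ω => by
        simp only [Pi.zero_apply, inner_sub_left]
        exact sub_nonneg.2 (hfstar.2 x (fn ω x)))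
      (hI.const_mul (2 * cψ)) (Filter.Eventually.of_forall fun ω => by
        simp only
        by_cases h : t₀ ≤ ‖gn ω x - gStar φ κ x‖
        · rw [Set.indicator_of_mem (show ω ∈ {ω | t₀ ≤ ‖gn ω x - gStar φ κ x‖} from h)]
          have h1 := (hfn ω).2 x (fstar x)
          have h2 : ⟪ψ (fn ω x) - ψ (fstar x), gStar φ κ x⟫
              ≤ ⟪ψ (fstar x) - ψ (fn ω x), gn ω x - gStar φ κ x⟫ := by
            simp only [inner_sub_left, inner_sub_right]
            linarith
          refine h2.trans ((real_inner_le_norm _ _).trans ?_)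
          gcongr
          exact hnorm2 _ _
        · rw [Set.indicator_of_notMem (show ω ∉ {ω | t₀ ≤ ‖gn ω x - gStar φ κ x‖} from h)]
          have heq : fstar x = fn ω x := by
            by_contra hne
            have := frontier_cross ψ (gStar φ κ x) (gn ω x) (fstar x) (fn ω x) hne
              (hfstar.2 x) ((hfn ω).2 x)
            apply hd
            refine this.trans_lt ?_
            exact (ENNReal.ofReal_lt_ofReal_iff ht₀).2 (not_le.1 h)
          rw [heq]
          simp)
    refine hmono.trans ?_
    rw [integral_const_mul]
    gcongr
  have hfin : ∫ x, ∫ ω, ⟪ψ (fn ω x) - ψ (fstar x), gStar φ κ x⟫ ∂P ∂μ ≤ 2 * cψ * BB L M t₀ := by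
    have := integral_mono_ae hEI.integral_prod_right (integrable_const (2 * cψ * BB L M t₀)) hpt
    simpa using this
  refine hfin.trans (le_of_eq ?_)
  unfold BB
  have e1 : L ^ (-(1 : ℝ) / 2) = 1 / √L := by
    rw [neg_div, Real.rpow_neg hL.le, Real.sqrt_eq_rpow]; simp only [one_div]
  have e2 : exp (-(t₀ ^ 2 * L) / 2) ^ ((1 : ℝ) / 2) = exp (-(L*t₀^2/4)) := by
    rw [← Real.exp_mul]; congr 1; ring
  have e3 : -(t₀ * L) / (2 * M) = -(L/(2*M)*t₀) := by ring
  rw [e1, e2, e3]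
  ring

end
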